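/- Let x ≥ 6 be an integer and let σ = ⌈√(x+1)⌉. Let p ≥ 3 be an integer and let α₀ = 0 < α₁ < … < α_{p−2} be integers with α₁ ≥ 2 and α_i > 2α_{i−1} for all i with 2 ≤ i ≤ p − 2. Set y = σ·x^{α_{p−2}} + x^{α_{p−3}} + … + x^{α₁} + 1. Then y² has exactly p(p−1)/2 + 1 non-zero digits in its base-x representation. -/

import Mathlib

/-- The number of non-zero digits of `n` in base `x`. -/
def nonzeroDigitCount (x n : ℕ) : ℕ := ((Nat.digits x n).filter (· ≠ 0)).length

lemma nonzeroDigitCount_zero (x : ℕ) : nonzeroDigitCount x 0 = 0 := by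
  simp [nonzeroDigitCount]

lemma nonzeroDigitCount_step {x : ℕ} (hx : 2 ≤ x) (n : ℕ) :
    nonzeroDigitCount x n = (if n % x = 0 then 0 else 1) + nonzeroDigitCount x (n / x) := by
  rcases Nat.eq_zero_or_pos n with rfl | hn
  · simp [nonzeroDigitCount]
  · unfold nonzeroDigitCount
    rw [Nat.digits_def' hx hn]
    split_ifs with h <;> simp [h, Nat.add_comm]

lemma nonzeroDigitCount_of_lt {x n : ℕ} (hx : 2 ≤ x) (hn : 0 < n) (h : n < x) :
    nonzeroDigitCount x n = 1 := by
  rw [nonzeroDigitCount_step hx, Nat.mod_eq_of_lt h, Nat.div_eq_of_lt h,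
    nonzeroDigitCount_zero, if_neg hn.ne']

lemma nonzeroDigitCount_add_pow_mul {x : ℕ} (hx : 2 ≤ x) (k a b : ℕ) (ha : a < x ^ k) :
    nonzeroDigitCount x (a + x ^ k * b) = nonzeroDigitCount x a + nonzeroDigitCount x b := by
  induction k generalizing a with
  | zero =>
    obtain rfl : a = 0 := by simpa using ha
    simp [nonzeroDigitCount_zero]
  | succ k ih =>
    have hx0 : 0 < x := by omega
    have he : a + x ^ (k + 1) * b = a + x * (x ^ k * b) := by ring
    have ha' : a / x < x ^ k := by
      rw [Nat.div_lt_iff_lt_mul hx0, ← pow_succ]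
      exact ha
    rw [nonzeroDigitCount_step hx, he, Nat.add_mul_mod_self_left,
      Nat.add_mul_div_left _ _ hx0, ih _ ha', nonzeroDigitCount_step hx a, add_assoc]

lemma nonzeroDigitCount_self {x : ℕ} (hx : 2 ≤ x) : nonzeroDigitCount x x = 1 := by
  have h := nonzeroDigitCount_add_pow_mul hx 1 0 1 (by simp; omega)
  simpa [nonzeroDigitCount_zero, nonzeroDigitCount_of_lt hx one_pos (by omega : 1 < x)] using h

section SparsePowers

variable {x : ℕ} {α : ℕ → ℕ}

lemma mul_sum_pow_lt (hx : 6 ≤ x) (m : ℕ) (hα : ∀ i < m, α i + 2 ≤ α (i + 1)) :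
    x * ∑ i ∈ Finset.range m, x ^ α i < x ^ α m := by
  induction m with
  | zero => simp [show 0 < x by omega]
  | succ m ih =>
    have h := ih fun i hi => hα i (by omega)
    have hle : x ^ (α m + 2) ≤ x ^ α (m + 1) :=
      Nat.pow_le_pow_right (by omega) (hα m (by omega))
    rw [Finset.sum_range_succ, mul_add]
    calc _ < x ^ α m + x * x ^ α m := by omega
      _ = x ^ α m * (1 + x) := by ring
      _ ≤ x ^ α m * x ^ 2 := Nat.mul_le_mul_left _ (by nlinarith)
      _ = x ^ (α m + 2) := by ring
      _ ≤ _ := hle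

lemma sq_sum_pow_lt (hx : 6 ≤ x) (m : ℕ) (hα : ∀ i < m, α i + 2 ≤ α (i + 1))
    (hα' : ∀ i < m, 2 * α i + 1 ≤ α (i + 1)) :
    (∑ i ∈ Finset.range m, x ^ α i) ^ 2 < x ^ α m := by
  cases m with
  | zero => simp [show 0 < x by omega]
  | succ m =>
    have h := mul_sum_pow_lt hx m fun i hi => hα i (by omega)
    have hle : x ^ (2 * α m + 1) ≤ x ^ α (m + 1) :=
      Nat.pow_le_pow_right (by omega) (hα' m (by omega))
    rw [Finset.sum_range_succ]
    set z := ∑ i ∈ Finset.range m, x ^ α i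
    have hz : 6 * z < x ^ α m := lt_of_le_of_lt (Nat.mul_le_mul_right _ hx) h
    calc (z + x ^ α m) ^ 2 < 6 * (x ^ α m) ^ 2 := by nlinarith
      _ ≤ x * (x ^ α m) ^ 2 := Nat.mul_le_mul_right _ hx
      _ = x ^ (2 * α m + 1) := by ring
      _ ≤ _ := hle

lemma nonzeroDigitCount_mul_sum_pow (hx : 6 ≤ x) {c : ℕ} (hcx : c ≤ x)
    (hc : nonzeroDigitCount x c = 1) (m : ℕ) (hα : ∀ i < m, α i + 2 ≤ α (i + 1)) :
    nonzeroDigitCount x (c * ∑ i ∈ Finset.range m, x ^ α i) = m := by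
  induction m with
  | zero => simp [nonzeroDigitCount_zero]
  | succ m ih =>
    have hα₀ : ∀ i < m, α i + 2 ≤ α (i + 1) := fun i hi => hα i (by omega)
    rw [Finset.sum_range_succ, mul_add, mul_comm c (x ^ α m),
      nonzeroDigitCount_add_pow_mul (by omega) _ _ _
        ((Nat.mul_le_mul_right _ hcx).trans_lt (mul_sum_pow_lt hx m hα₀)), ih hα₀, hc]

lemma nonzeroDigitCount_sq_add_sum_pow (hx : 6 ≤ x) {σ : ℕ} (hσx : 2 * σ ≤ x)
    (hσ : nonzeroDigitCount x (2 * σ) = 1) (m : ℕ) (hα : ∀ i < m, α i + 2 ≤ α (i + 1))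
    (hα' : ∀ i < m, 2 * α i + 1 ≤ α (i + 1)) :
    nonzeroDigitCount x ((σ * x ^ α m + ∑ i ∈ Finset.range m, x ^ α i) ^ 2) =
      nonzeroDigitCount x ((∑ i ∈ Finset.range m, x ^ α i) ^ 2) + m +
        nonzeroDigitCount x (σ ^ 2) := by
  have hx2 : 2 ≤ x := by omega
  have he : (σ * x ^ α m + ∑ i ∈ Finset.range m, x ^ α i) ^ 2 =
      (∑ i ∈ Finset.range m, x ^ α i) ^ 2 +
        x ^ α m * ((2 * σ) * ∑ i ∈ Finset.range m, x ^ α i + x ^ α m * σ ^ 2) := by ring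
  rw [he, nonzeroDigitCount_add_pow_mul hx2 _ _ _ (sq_sum_pow_lt hx m hα hα'),
    nonzeroDigitCount_add_pow_mul hx2 _ _ _
      ((Nat.mul_le_mul_right _ hσx).trans_lt (mul_sum_pow_lt hx m hα)),
    nonzeroDigitCount_mul_sum_pow hx hσx hσ m hα, add_assoc]

lemma nonzeroDigitCount_sq_sum_pow (hx : 6 ≤ x) (m : ℕ)
    (hα : ∀ i < m, α i + 2 ≤ α (i + 1)) (hα' : ∀ i < m, 2 * α i + 1 ≤ α (i + 1)) :
    nonzeroDigitCount x ((∑ i ∈ Finset.range m, x ^ α i) ^ 2) = (m + 1).choose 2 := by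
  induction m with
  | zero => simp [nonzeroDigitCount_zero]
  | succ m ih =>
    have hα₀ : ∀ i < m, α i + 2 ≤ α (i + 1) := fun i hi => hα i (by omega)
    have hα₁ : ∀ i < m, 2 * α i + 1 ≤ α (i + 1) := fun i hi => hα' i (by omega)
    have h := nonzeroDigitCount_sq_add_sum_pow (σ := 1) hx (by omega)
      (nonzeroDigitCount_of_lt (by omega) (by omega) (by omega)) m hα₀ hα₁
    rw [one_mul, one_pow, nonzeroDigitCount_of_lt (by omega) one_pos (by omega), ih hα₀ hα₁] at h
    rw [Finset.sum_range_succ, add_comm, h, Nat.choose_succ_succ' (m + 1) 1, Nat.choose_one_right]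
    ring

end SparsePowers

theorem base_x_digit_count_special_construction
    (x : ℕ) (hx : 6 ≤ x) (σ : ℕ) (hσ : σ = ⌈Real.sqrt (x + 1)⌉₊)
    (p : ℕ) (hp : 3 ≤ p)
    (α : ℕ → ℕ) (hα0 : α 0 = 0) (hα1 : 2 ≤ α 1)
    (hmono : ∀ i, i + 1 ≤ p - 2 → α i < α (i + 1))
    (hgt : ∀ i, 2 ≤ i → i ≤ p - 2 → α i > 2 * α (i - 1)) :
    ((Nat.digits x
      ((σ * x ^ α (p - 2) + ∑ i ∈ Finset.range (p - 2), x ^ α i) ^ 2)).filter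
        (· ≠ 0)).length = p * (p - 1) / 2 + 1 := by
  obtain ⟨m, rfl⟩ : ∃ m, p = m + 2 := ⟨p - 2, by omega⟩
  simp only [Nat.add_sub_cancel] at *
  have hx2 : 2 ≤ x := by omega
  have hlow : x + 1 ≤ σ ^ 2 := by
    have h : Real.sqrt (x + 1) ≤ σ := hσ ▸ Nat.le_ceil _
    have h' := (Real.sqrt_le_left (by positivity)).1 h
    exact_mod_cast h'
  obtain ⟨s, rfl⟩ : ∃ s, σ = s + 1 := ⟨σ - 1, by
    have : σ ≠ 0 := by rintro rfl; simp at hlow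
    omega⟩
  have hup : s ^ 2 ≤ x := by
    have h : (s : ℝ) < Real.sqrt (x + 1) := Nat.lt_ceil.1 (by omega)
    have h' := (Real.lt_sqrt (by positivity)).1 h
    have h'' : s ^ 2 < x + 1 := by exact_mod_cast h'
    omega
  have hσx : 2 * (s + 1) ≤ x := by
    by_contra! h
    have : s < 4 := by nlinarith
    interval_cases s <;> omega
  have hσ2 : (s + 1) ^ 2 < 2 * x := by
    rcases Nat.lt_or_ge s 3 with h | h
    · interval_cases s <;> omega
    · nlinarith
  have h2σ : nonzeroDigitCount x (2 * (s + 1)) = 1 := by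
    rcases hσx.lt_or_eq with h | h
    · exact nonzeroDigitCount_of_lt hx2 (by omega) h
    · rw [h, nonzeroDigitCount_self hx2]
  have hsq : nonzeroDigitCount x ((s + 1) ^ 2) = 2 := by
    have h := nonzeroDigitCount_add_pow_mul hx2 1 ((s + 1) ^ 2 - x) 1 (by rw [pow_one]; omega)
    rw [pow_one, mul_one, Nat.sub_add_cancel (by omega),
      nonzeroDigitCount_of_lt (n := (s + 1) ^ 2 - x) hx2 (by omega) (by omega),
      nonzeroDigitCount_of_lt hx2 one_pos (by omega)] at h
    exact h
  have hge : ∀ i < m, 2 ≤ α (i + 1) := by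
    intro i
    induction i with
    | zero => exact fun _ => hα1
    | succ i ih =>
      intro hi
      have := ih (by omega)
      have := hmono (i + 1) (by omega)
      omega
  have hdouble : ∀ i < m, 2 * α i + 1 ≤ α (i + 1) := by
    rintro (_ | i) hi
    · simp only [hα0, Nat.zero_add]; omega
    · exact hgt (i + 2) (by omega) (by omega)
  have hgap : ∀ i < m, α i + 2 ≤ α (i + 1) := by
    rintro (_ | i) hi
    · simpa [hα0] using hα1
    · have := hge i (by omega)
      have := hdouble (i + 1) hi
      omega
  have key := nonzeroDigitCount_sq_add_sum_pow hx hσx h2σ m hgap hdouble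
  rw [nonzeroDigitCount_sq_sum_pow hx m hgap hdouble, hsq] at key
  have hchoose : (m + 2) * (m + 2 - 1) / 2 = (m + 1) + (m + 1).choose 2 := by
    rw [← Nat.choose_two_right, Nat.choose_succ_succ' (m + 1) 1, Nat.choose_one_right]
  rw [hchoose]
  unfold nonzeroDigitCount at key
  omega
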